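/- Let F be a finite union-closed family of finite sets with ∅ ∈ F whose generators J(F) form a graph, let U = {a, b} ∈ J(F) with a ≠ b, and let H be a filter of 2^{N²∖U} such that every minimal member X of H satisfies |E_{F,U}(X)| = 1. Then for every X ∈ H and every Y ⊆ U, π_F(X ∪ Y) ∩ U = Y. -/

import Mathlib

open Finset

/-- `F` is union-closed. -/
def UnionClosed {α : Type*} [DecidableEq α] (F : Finset (Finset α)) : Prop :=
  ∀ A ∈ F, ∀ B ∈ F, A ∪ B ∈ F

/-- The generators `J(F)`: nonempty members of `F` that are not the union of the
members of `F` properly contained in them. -/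
def gens {α : Type*} [DecidableEq α] (F : Finset (Finset α)) : Finset (Finset α) :=
  F.filter (fun U => U.Nonempty ∧ (F.filter (fun A => A ⊂ U)).sup id ≠ U)

/-- The closure `π_F(X)`: the union of all members of `F` contained in `X`. -/
def piF {α : Type*} [DecidableEq α] (F : Finset (Finset α)) (X : Finset α) : Finset α :=
  (F.filter (fun A => A ⊆ X)).sup id

/-- `F ∨ H = {A ∪ B : A ∈ F, B ∈ H}`. -/
def famJoin {α : Type*} [DecidableEq α] (F H : Finset (Finset α)) : Finset (Finset α) :=
  (F ×ˢ H).image (fun p => p.1 ∪ p.2)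

/-- `F'` is an extension of `(F, U)`: `F' = F ∨ H` for some nonempty union-closed
family `H` with `(⋃ H) ∩ U = ∅`. -/
def IsExtension {α : Type*} [DecidableEq α] (F : Finset (Finset α)) (U : Finset α)
    (F' : Finset (Finset α)) : Prop :=
  ∃ H : Finset (Finset α), H.Nonempty ∧ UnionClosed H ∧ (H.sup id) ∩ U = ∅ ∧ F' = famJoin F H

/-- The restriction of `F` away from `U`: `F_{∖U} = {A ∖ U : A ∈ F}`. -/
def resAway {α : Type*} [DecidableEq α] (F : Finset (Finset α)) (U : Finset α) :
    Finset (Finset α) :=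
  F.image (fun A => A \ U)

/-- `E_{F,U}(X)`: the subsets `Y ⊆ U` with `π_F(X ∪ Y) ∩ U = Y` and
`π_F(X ∪ Y) ⊇ π_F(X ∪ U) \ U`. -/
def Efam {α : Type*} [DecidableEq α] (F : Finset (Finset α)) (U X : Finset α) :
    Finset (Finset α) :=
  U.powerset.filter (fun Y => piF F (X ∪ Y) ∩ U = Y ∧ piF F (X ∪ U) \ U ⊆ piF F (X ∪ Y))

/-- `μ_{F,F'}(U) = (Σ_{X ∈ F'_{∖U}} |E_{F,U}(X)|) / |F'_{∖U}|`. -/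
def mu {α : Type*} [DecidableEq α] (F : Finset (Finset α)) (U : Finset α)
    (F' : Finset (Finset α)) : ℚ :=
  (∑ X ∈ resAway F' U, ((Efam F U X).card : ℚ)) / ((resAway F' U).card : ℚ)

/-- The union-closed family generated by `G` (all unions of subfamilies of `G`;
it contains `∅` as the empty union). -/
def genUC {α : Type*} [DecidableEq α] (G : Finset (Finset α)) : Finset (Finset α) :=
  G.powerset.image (fun S => S.sup id)

/-- The lattice neighborhood `𝒩_F(U)`: the union-closed family generated by `{∅}`
together with the generators of `F` meeting `U`. -/
def latNbhd {α : Type*} [DecidableEq α] (F : Finset (Finset α)) (U : Finset α) :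
    Finset (Finset α) :=
  genUC ((gens F).filter (fun V => (V ∩ U).Nonempty))

/-- The third lattice neighborhood `𝒩³_F(U) = 𝒩_F(⋃ 𝒩_F(U))`. -/
def latNbhd3 {α : Type*} [DecidableEq α] (F : Finset (Finset α)) (U : Finset α) :
    Finset (Finset α) :=
  latNbhd F ((latNbhd F U).sup id)

/-- The neighborhood `N_F(X) = X ∪ ⋃ {V ∈ J(F) : V ∩ X ≠ ∅}`. -/
def nbhd {α : Type*} [DecidableEq α] (F : Finset (Finset α)) (X : Finset α) : Finset α :=
  X ∪ ((gens F).filter (fun V => (V ∩ X).Nonempty)).sup id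

/-- `H` is a filter of `2^S`: a nonempty family of subsets of `S` closed upward in `S`. -/
def IsFilterOn {α : Type*} [DecidableEq α] (S : Finset α) (H : Finset (Finset α)) : Prop :=
  H.Nonempty ∧ (∀ X ∈ H, X ⊆ S) ∧ ∀ X ∈ H, ∀ Y, X ⊆ Y → Y ⊆ S → Y ∈ H

/-- `F'` minimizes `μ` in `D` (among extensions of `(F, U)` with union inside `D`). -/
def MinimizesMu {α : Type*} [DecidableEq α] (F : Finset (Finset α)) (U D : Finset α)
    (F' : Finset (Finset α)) : Prop :=
  F'.sup id ⊆ D ∧ ∀ F'', IsExtension F U F'' → F''.sup id ⊆ D → mu F U F' ≤ mu F U F''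

/-- The degree of `U` in the graph `G`: the number of members of `G` other than `U`
meeting `U`. -/
def degG {α : Type*} [DecidableEq α] (G : Finset (Finset α)) (U : Finset α) : ℕ :=
  (G.filter (fun V => V ≠ U ∧ (V ∩ U).Nonempty)).card

theorem mem_piF {α : Type*} [DecidableEq α] {F : Finset (Finset α)} {X : Finset α} {z : α} :
    z ∈ piF F X ↔ ∃ A ∈ F, A ⊆ X ∧ z ∈ A := by
  simp [piF, Finset.mem_sup, and_assoc]

theorem piF_subset {α : Type*} [DecidableEq α] (F : Finset (Finset α)) (X : Finset α) :
    piF F X ⊆ X := by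
  intro z hz
  obtain ⟨A, -, hAX, hzA⟩ := mem_piF.1 hz
  exact hAX hzA

theorem piF_mono {α : Type*} [DecidableEq α] (F : Finset (Finset α)) {X Y : Finset α}
    (h : X ⊆ Y) : piF F X ⊆ piF F Y := by
  intro z hz
  obtain ⟨A, hA, hAX, hzA⟩ := mem_piF.1 hz
  exact mem_piF.2 ⟨A, hA, hAX.trans h, hzA⟩

theorem mem_of_mem_gens {α : Type*} [DecidableEq α] {F : Finset (Finset α)} {V : Finset α}
    (hV : V ∈ gens F) : V ∈ F :=
  (Finset.mem_filter.1 hV).1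

/-- Every element of a member of `F` lies in a generator contained in that member. -/
theorem exists_gens_subset {α : Type*} [DecidableEq α] {F : Finset (Finset α)} {z : α}
    (A : Finset α) (hA : A ∈ F) (hz : z ∈ A) : ∃ V ∈ gens F, V ⊆ A ∧ z ∈ V := by
  induction A using Finset.strongInduction with
  | H A ih =>
    by_cases hg : A ∈ gens F
    · exact ⟨A, hg, Finset.Subset.refl A, hz⟩
    · have hsup : (F.filter (fun B => B ⊂ A)).sup id = A := by
        by_contra hne
        exact hg (Finset.mem_filter.2 ⟨hA, ⟨z, hz⟩, hne⟩)
      rw [← hsup, Finset.mem_sup] at hz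
      obtain ⟨B, hB, hzB⟩ := hz
      obtain ⟨hBF, hBA⟩ := Finset.mem_filter.1 hB
      obtain ⟨V, hV, hVB, hzV⟩ := ih B hBA hBF hzB
      exact ⟨V, hV, hVB.trans hBA.1, hzV⟩

/-- If the generators form a graph and `a` is not in the closure of `X ∪ {a}`, then the
generators contained in `X ∪ {a, b}` and meeting `X` avoid `a`. -/
theorem subset_union_singleton_of_notMem_piF {α : Type*} [DecidableEq α]
    {F : Finset (Finset α)} (hgraph : ∀ V ∈ gens F, V.card = 1 ∨ V.card = 2) {a b : α}
    {X V : Finset α} (ha : a ∉ piF F (X ∪ {a})) (hV : V ∈ gens F) (hVX : V ⊆ X ∪ {a, b})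
    {y : α} (hyV : y ∈ V) (hy : y ∉ ({a, b} : Finset α)) : V ⊆ X ∪ {b} := by
  have hyX : y ∈ X := (Finset.mem_union.1 (hVX hyV)).resolve_right hy
  have haV : a ∉ V := by
    intro haV
    have hya : y ≠ a := by
      rintro rfl
      simp at hy
    have hpair : ({y, a} : Finset α) = V := by
      apply Finset.eq_of_subset_of_card_le
      · simp [Finset.insert_subset_iff, hyV, haV]
      · rw [Finset.card_pair hya]
        rcases hgraph V hV with h | h <;> omega
    refine ha (mem_piF.2 ⟨V, mem_of_mem_gens hV, ?_, haV⟩)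
    rw [← hpair]
    simp [Finset.insert_subset_iff, hyX]
  intro z hz
  have := hVX hz
  simp only [Finset.mem_union, Finset.mem_insert, Finset.mem_singleton] at this ⊢
  rcases this with h | rfl | h
  · exact Or.inl h
  · exact absurd hz haV
  · exact Or.inr h

theorem self_mem_Efam {α : Type*} [DecidableEq α] {F : Finset (Finset α)} {U : Finset α}
    (hU : U ∈ F) (X : Finset α) : U ∈ Efam F U X := by
  refine Finset.mem_filter.2 ⟨Finset.mem_powerset_self U, ?_, Finset.sdiff_subset⟩
  exact Finset.inter_eq_right.2 fun z hz =>
    mem_piF.2 ⟨U, hU, Finset.subset_union_right, hz⟩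

theorem mem_piF_of_card_Efam_eq_one {α : Type*} [DecidableEq α] {F : Finset (Finset α)}
    (hgraph : ∀ V ∈ gens F, V.card = 1 ∨ V.card = 2) {a b : α} (hab : a ≠ b)
    (hU : ({a, b} : Finset α) ∈ F) {X : Finset α} (hX : Disjoint X {a, b})
    (hcard : (Efam F {a, b} X).card = 1) : a ∈ piF F (X ∪ {a}) := by
  by_contra ha
  have huniq : ∀ Y ∈ Efam F {a, b} X, Y = {a, b} := fun Y hY =>
    Finset.card_le_one.1 hcard.le Y hY _ (self_mem_Efam hU X)
  have haX : a ∉ X := fun h => Finset.disjoint_left.1 hX h (by simp)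
  have hcover : piF F (X ∪ {a, b}) \ {a, b} ⊆ piF F (X ∪ {b}) := by
    intro y hy
    obtain ⟨hy, hyU⟩ := Finset.mem_sdiff.1 hy
    obtain ⟨A, hA, hAX, hyA⟩ := mem_piF.1 hy
    obtain ⟨V, hV, hVA, hyV⟩ := exists_gens_subset A hA hyA
    exact mem_piF.2 ⟨V, mem_of_mem_gens hV,
      subset_union_singleton_of_notMem_piF hgraph ha hV (hVA.trans hAX) hyV hyU, hyV⟩
  have hb : b ∉ piF F (X ∪ {b}) := by
    intro hb
    have hmem : ({b} : Finset α) ∈ Efam F {a, b} X := by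
      refine Finset.mem_filter.2 ⟨by simp, ?_, hcover⟩
      ext z
      simp only [Finset.mem_inter, Finset.mem_insert, Finset.mem_singleton]
      constructor
      · rintro ⟨hz, rfl | rfl⟩
        · have := piF_subset F _ hz
          simp [haX, hab] at this
        · rfl
      · rintro rfl
        exact ⟨hb, Or.inr rfl⟩
    have : a ∈ ({b} : Finset α) := by
      rw [huniq _ hmem]
      simp
    exact hab (Finset.mem_singleton.1 this)
  have hmem : (∅ : Finset α) ∈ Efam F {a, b} X := by
    refine Finset.mem_filter.2 ⟨by simp, ?_, ?_⟩
    · rw [Finset.union_empty, ← Finset.disjoint_iff_inter_eq_empty]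
      exact hX.mono_left (piF_subset F X)
    · intro y hy
      obtain ⟨A, hA, hAX, hyA⟩ := mem_piF.1 (hcover hy)
      rw [Finset.union_empty]
      refine mem_piF.2 ⟨A, hA, fun z hz => ?_, hyA⟩
      refine (Finset.mem_union.1 (hAX hz)).resolve_right fun hzb => hb ?_
      rw [Finset.mem_singleton] at hzb
      exact mem_piF.2 ⟨A, hA, hAX, hzb ▸ hz⟩
  simpa using (huniq _ hmem).symm

/-- Corollary 3.22: with `J(F)` a graph, `U = {a, b} ∈ J(F)` (`a ≠ b`), and `H`
a filter of `2^{N²∖U}` whose minimal members `X` satisfy `|E_{F,U}(X)| = 1`,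
for every `X ∈ H` and `Y ⊆ U` we have `π_F(X ∪ Y) ∩ U = Y`. -/
theorem stmt16 {α : Type*} [DecidableEq α] (F : Finset (Finset α))
    (hUC : UnionClosed F) (hempty : ∅ ∈ F)
    (hgraph : ∀ V ∈ gens F, V.card = 1 ∨ V.card = 2)
    (a b : α) (hab : a ≠ b) (hU : ({a, b} : Finset α) ∈ gens F)
    (H : Finset (Finset α))
    (hH : IsFilterOn (nbhd F (nbhd F {a, b}) \ {a, b}) H)
    (hmin : ∀ X ∈ H, (∀ Z, Z ⊂ X → Z ∉ H) → (Efam F {a, b} X).card = 1) :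
    ∀ X ∈ H, ∀ Y ⊆ ({a, b} : Finset α),
      piF F (X ∪ Y) ∩ ({a, b} : Finset α) = Y := by
  intro X hXH Y hY
  obtain ⟨-, hsub, -⟩ := hH
  obtain ⟨M, hMX, hM⟩ := H.exists_le_minimal hXH
  have hdisj : ∀ Z ∈ H, Disjoint Z ({a, b} : Finset α) := fun Z hZ =>
    Finset.disjoint_left.2 fun z hz => (Finset.mem_sdiff.1 (hsub Z hZ hz)).2
  have hcard : (Efam F {a, b} M).card = 1 :=
    hmin M hM.prop fun Z hZM hZ => hM.not_lt hZ hZM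
  have hUF : ({a, b} : Finset α) ∈ F := mem_of_mem_gens hU
  have ha : a ∈ piF F (X ∪ {a}) :=
    piF_mono F (Finset.union_subset_union_left hMX)
      (mem_piF_of_card_Efam_eq_one hgraph hab hUF (hdisj M hM.prop) hcard)
  have hb : b ∈ piF F (X ∪ {b}) := by
    refine piF_mono F (Finset.union_subset_union_left hMX)
      (mem_piF_of_card_Efam_eq_one (b := a) hgraph hab.symm ?_ ?_ ?_)
    · rwa [Finset.pair_comm]
    · rw [Finset.pair_comm]
      exact hdisj M hM.prop
    · rwa [Finset.pair_comm]
  ext z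
  rw [Finset.mem_inter]
  constructor
  · rintro ⟨hz, hzU⟩
    exact (Finset.mem_union.1 (piF_subset F _ hz)).resolve_left fun hzX =>
      Finset.disjoint_left.1 (hdisj X hXH) hzX hzU
  · intro hz
    have hzU := hY hz
    refine ⟨piF_mono F (Finset.union_subset_union_right
      (Finset.singleton_subset_iff.2 hz)) ?_, hzU⟩
    rcases Finset.mem_insert.1 hzU with rfl | h
    · exact ha
    · rw [Finset.mem_singleton.1 h]
      exact hb
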